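/- (Main approximation theorem.) There exist constants ε_0 > 0 and C_0 ≥ 1, depending only on n and d, with the following property. Let E ⊂ R^n be a nonempty closed set, r_0 > 0, and 0 < ε < ε_0, such that for every x ∈ E there is a d-plane P through x with d_{x,r_0}(E,P) ≤ ε. Then there is a closed set Σ_0 ⊂ R^n which is a d-dimensional C^1 embedded submanifold without boundary, such that dist(x, Σ_0) ≤ C_0 ε r_0 for all x ∈ E, dist(x, E) ≤ C_0 ε r_0 for all x ∈ Σ_0, and for each y ∈ Σ_0, Σ_0 coincides in B(y, 10^{-2} r_0) with the graph of a C_0 ε-Lipschitz map from a d-plane through y to its orthogonal complement. -/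

import Mathlib

open Metric Set

/-- The normalized local Hausdorff distance. -/
noncomputable def locDist {n : ℕ} (x : EuclideanSpace ℝ (Fin n)) (r : ℝ)
    (A B : Set (EuclideanSpace ℝ (Fin n))) : ℝ :=
  r⁻¹ * sSup ((fun y => Metric.infDist y B) '' (A ∩ Metric.closedBall x r))
    + r⁻¹ * sSup ((fun y => Metric.infDist y A) '' (B ∩ Metric.closedBall x r))

section FlatSets

open MeasureTheory

variable {V : Type*} [NormedAddCommGroup V] [InnerProductSpace ℝ V] [FiniteDimensional ℝ V]

/-- At scale one around `x`, the set `E` and the plane `x + K` are `ε`-close in both directions. -/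
def FlatAt (E : Set V) (ε : ℝ) (x : V) (K : Submodule ℝ V) : Prop :=
  (∀ y ∈ E, ‖y - x‖ ≤ 1 → ‖Kᗮ.starProjection (y - x)‖ ≤ ε) ∧
    ∀ w ∈ K, ‖w‖ ≤ 1 → ∃ y ∈ E, ‖x + w - y‖ ≤ ε

theorem FlatAt.infDist_le {E : Set V} {ε : ℝ} {x : V} {K : Submodule ℝ V} (h : FlatAt E ε x K)
    {z : V} (hz : ‖z - x‖ ≤ 1) : infDist z E ≤ ‖Kᗮ.starProjection (z - x)‖ + ε := by
  obtain ⟨y, hy, hxy⟩ := h.2 (K.starProjection (z - x)) (K.starProjection_apply_mem _)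
    ((K.norm_starProjection_apply_le _).trans hz)
  have hsplit := K.starProjection_add_starProjection_orthogonal (z - x)
  calc infDist z E ≤ dist z y := infDist_le_dist_of_mem hy
    _ = ‖Kᗮ.starProjection (z - x) + (x + K.starProjection (z - x) - y)‖ := by
        rw [dist_eq_norm]
        congr 1
        calc z - y = (z - x) + (x - y) := by abel
          _ = K.starProjection (z - x) + Kᗮ.starProjection (z - x) + (x - y) := by rw [hsplit]
          _ = _ := by abel
    _ ≤ _ := (norm_add_le _ _).trans (by gcongr)

theorem FlatAt.norm_le_infDist {E : Set V} {ε : ℝ} {x : V} {K : Submodule ℝ V}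
    (h : FlatAt E ε x K) (hE : IsClosed E) (hx : x ∈ E) {z : V} (hz : ‖z - x‖ ≤ 1 / 2) :
    ‖Kᗮ.starProjection (z - x)‖ ≤ infDist z E + ε := by
  obtain ⟨y, hy, hzy⟩ := hE.exists_infDist_eq_dist ⟨x, hx⟩ z
  have h1 : dist z y ≤ ‖z - x‖ := by
    rw [← hzy, ← dist_eq_norm]; exact infDist_le_dist_of_mem hx
  have h2 : ‖y - x‖ ≤ 1 := by
    have := dist_triangle y z x
    rw [dist_comm y z, dist_eq_norm z x, dist_eq_norm y x] at this
    linarith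
  have h3 := h.1 y hy h2
  have h4 : z - x = (z - y) + (y - x) := by abel
  rw [hzy, h4, map_add, dist_eq_norm]
  exact (norm_add_le _ _).trans (add_le_add (Kᗮ.norm_starProjection_apply_le _) h3)

theorem FlatAt.abs_sq_sub_sq_le {E : Set V} {ε : ℝ} {x : V} {K : Submodule ℝ V}
    (h : FlatAt E ε x K) (hE : IsClosed E) (hx : x ∈ E) {z : V} (hz : ‖z - x‖ ≤ 1 / 2) :
    |infDist z E ^ 2 - ‖Kᗮ.starProjection (z - x)‖ ^ 2| ≤ ε := by
  have h1 := h.infDist_le (z := z) (by linarith)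
  have h2 := h.norm_le_infDist hE hx hz
  have h3 : infDist z E ≤ 1 / 2 := by
    refine le_trans ?_ hz
    rw [← dist_eq_norm]; exact infDist_le_dist_of_mem hx
  have h4 := (Kᗮ.norm_starProjection_apply_le (z - x)).trans hz
  have h5 := norm_nonneg (Kᗮ.starProjection (z - x))
  have h6 := infDist_nonneg (x := z) (s := E)
  have h7 : |infDist z E - ‖Kᗮ.starProjection (z - x)‖| ≤ ε := abs_le.2 ⟨by linarith, by linarith⟩
  rw [sq_sub_sq, abs_mul]
  have h8 : |infDist z E + ‖Kᗮ.starProjection (z - x)‖| ≤ 1 := abs_le.2 ⟨by linarith, by linarith⟩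
  calc _ ≤ 1 * ε := mul_le_mul h8 h7 (abs_nonneg _) zero_le_one
    _ = ε := one_mul _

/-- The difference of the functions `g` and `z ↦ ‖Q (z - x)‖ ^ 2`, with `Q` the projection onto
the orthogonal complement of `K`, is `c`-Lipschitz around `x`. -/
def NearQuadratic (g : V → ℝ) (c : ℝ) (x : V) (K : Submodule ℝ V) : Prop :=
  ∀ z ∈ ball x (3 / 8), ∀ z' ∈ ball x (3 / 8),
    |(g z - ‖Kᗮ.starProjection (z - x)‖ ^ 2) - (g z' - ‖Kᗮ.starProjection (z' - x)‖ ^ 2)| ≤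
      c * ‖z - z'‖

variable (V) in
theorem exists_nearQuadratic [MeasurableSpace V] [BorelSpace V] :
    ∃ C : ℝ, 0 ≤ C ∧ ∀ E : Set V, IsClosed E → ∃ g : V → ℝ, ContDiff ℝ 1 g ∧
      ∀ ε : ℝ, ∀ x ∈ E, ∀ K : Submodule ℝ V, FlatAt E ε x K → NearQuadratic g (C * ε) x K := by
  let φ : ContDiffBump (0 : V) := ⟨1 / 16, 1 / 8, by norm_num, by norm_num⟩
  let ψ : V → ℝ := φ.normed volume
  have hψc : HasCompactSupport ψ := φ.hasCompactSupport_normed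
  have hψs : ContDiff ℝ 1 ψ := φ.contDiff_normed (n := 1)
  obtain ⟨L, hL⟩ := hψs.lipschitzWith_of_hasCompactSupport hψc (by norm_num)
  have hψ0 : ∀ v : V, 1 / 8 ≤ ‖v‖ → ψ v = 0 := by
    intro v hv
    have : v ∉ Function.support ψ := by
      rw [φ.support_normed_eq, mem_ball_zero_iff]
      exact not_lt.2 hv
    simpa using this
  refine ⟨L * volume.real (closedBall (0 : V) (1 / 2)), by positivity, fun E hE => ?_⟩
  let D : V → ℝ := fun z => infDist z E ^ 2
  have hD : Continuous D := (continuous_infDist_pt E).pow 2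
  let g : V → ℝ := convolution ψ D (ContinuousLinearMap.lsmul ℝ ℝ) volume
  have hg : ∀ z, g z = ∫ t, ψ t * D (z - t) := fun z => rfl
  refine ⟨g, hψc.contDiff_convolution_left (n := 1) _ hψs hD.locallyIntegrable, ?_⟩
  intro ε x hx K hK
  set Q := Kᗮ.starProjection with hQ
  let u : V → ℝ := fun z => ‖Q (z - x)‖ ^ 2
  have hu : Continuous u := by fun_prop
  have hψint : ∀ f : V → ℝ, Continuous f → Integrable (fun t => ψ t * f t) := fun f hf =>
    (hψs.continuous.mul hf).integrable_of_hasCompactSupport hψc.mul_right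
  have hodd : ∀ v : V, ∫ t, ψ t * inner ℝ v (Q t) = 0 := by
    intro v
    have := integral_neg_eq_self (fun t => ψ t * inner ℝ v (Q t)) (volume : Measure V)
    simp only [map_neg, inner_neg_right, mul_neg, ψ, φ.normed_neg, integral_neg] at this
    simp only [ψ]
    linarith
  have hconst : ∀ z, ∫ t, ψ t * u (z - t) = u z + ∫ t, ψ t * ‖Q t‖ ^ 2 := by
    intro z
    have h1 : ∀ t, ψ t * u (z - t) =
        ψ t * u z - 2 * (ψ t * inner ℝ (Q (z - x)) (Q t)) + ψ t * ‖Q t‖ ^ 2 := by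
      intro t
      have : z - t - x = (z - x) - t := by abel
      simp only [u, this, map_sub Q (z - x) t, norm_sub_sq_real]
      ring
    simp_rw [h1]
    rw [integral_add, integral_sub, integral_const_mul, hodd, integral_mul_const]
    · have : ∫ t, ψ t = 1 := φ.integral_normed
      rw [this]; ring
    · exact hψint _ continuous_const
    · exact (hψint (fun t => inner ℝ (Q (z - x)) (Q t)) (by fun_prop)).const_mul 2
    · exact (hψint _ continuous_const).sub
        ((hψint (fun t => inner ℝ (Q (z - x)) (Q t)) (by fun_prop)).const_mul 2)
    · exact hψint (fun t => ‖Q t‖ ^ 2) (by fun_prop)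
  have hdiff : ∀ z, g z - u z = (∫ v, ψ (z - v) * (D v - u v)) + ∫ t, ψ t * ‖Q t‖ ^ 2 := by
    intro z
    have h1 : ∫ v, ψ (z - v) * (D v - u v) = ∫ t, ψ t * (D (z - t) - u (z - t)) := by
      rw [← integral_sub_left_eq_self _ volume z]
      simp
    have h2 : ∫ t, ψ t * (D (z - t) - u (z - t)) = g z - ∫ t, ψ t * u (z - t) := by
      rw [hg, ← integral_sub (hψint (fun t => D (z - t)) (by fun_prop))
        (hψint (fun t => u (z - t)) (by fun_prop))]
      simp_rw [mul_sub]
    rw [h1, h2, hconst]; ring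
  have hψint' : ∀ z, Integrable (fun v => ψ (z - v) * (D v - u v)) := by
    intro z
    have h1 := (hψint (fun t => D (z - t) - u (z - t)) (by fun_prop)).comp_sub_left z
    simpa using h1
  intro z hz z' hz'
  rw [mem_ball, dist_eq_norm] at hz hz'
  change |(g z - u z) - (g z' - u z')| ≤ _
  rw [hdiff, hdiff, add_sub_add_right_eq_sub, ← integral_sub (hψint' z) (hψint' z')]
  rw [← setIntegral_eq_integral_of_forall_compl_eq_zero (s := closedBall x (1 / 2)),
    ← Real.norm_eq_abs]
  · refine (norm_setIntegral_le_of_norm_le_const (C := L * ‖z - z'‖ * ε)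
      measure_closedBall_lt_top ?_).trans (le_of_eq ?_)
    · intro v hv
      rw [mem_closedBall, dist_eq_norm] at hv
      rw [← sub_mul, norm_mul]
      have h1 := hL.norm_sub_le (z - v) (z' - v)
      rw [sub_sub_sub_cancel_right] at h1
      exact mul_le_mul h1 (hK.abs_sq_sub_sq_le hE hx hv) (norm_nonneg _) (by positivity)
    · rw [measureReal_def, measureReal_def, Measure.addHaar_closedBall_center]
      ring
  · intro v hv
    rw [mem_closedBall, dist_eq_norm, not_le] at hv
    have key : ∀ y : V, ‖y - x‖ < 3 / 8 → ψ (y - v) = 0 := by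
      intro y hy
      apply hψ0
      have : ‖v - x‖ ≤ ‖y - x‖ + ‖y - v‖ := by
        rw [show v - x = (y - x) - (y - v) by abel]; exact norm_sub_le _ _
      linarith
    rw [key z hz, key z' hz']; simp

end FlatSets

section DiscreteDerivatives

variable {V : Type*} [NormedAddCommGroup V] [InnerProductSpace ℝ V]
variable {ι : Type*} [Fintype ι]

theorem norm_sum_smul_orthonormalBasis_le (b : OrthonormalBasis ι ℝ V) {c : ℝ} {a : ι → ℝ}
    (ha : ∀ i, |a i| ≤ c) : ‖∑ i, a i • b i‖ ≤ Fintype.card ι * c := by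
  refine (norm_sum_le _ _).trans ?_
  refine (Finset.sum_le_sum (g := fun _ => c) fun i _ => ?_).trans (le_of_eq ?_)
  · rw [norm_smul, b.norm_eq_one, mul_one]; exact ha i
  · simp

/-- The gradient of half of `g`, approximated by central differences of step `1 / 16`. -/
noncomputable def discreteGrad (b : OrthonormalBasis ι ℝ V) (g : V → ℝ) (z : V) : V :=
  ∑ i, (4 * (g (z + (1 / 16 : ℝ) • b i) - g (z - (1 / 16 : ℝ) • b i))) • b i

/-- The derivative of `Φ`, approximated by forward differences of step `1 / 16`. -/
noncomputable def discreteDeriv (b : OrthonormalBasis ι ℝ V) (Φ : V → V) (z : V) : V →L[ℝ] V :=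
  ∑ i, (innerSL ℝ (b i)).smulRight ((16 : ℝ) • (Φ (z + (1 / 16 : ℝ) • b i) - Φ z))

theorem ContDiff.discreteGrad (b : OrthonormalBasis ι ℝ V) {g : V → ℝ} (hg : ContDiff ℝ 1 g) :
    ContDiff ℝ 1 (discreteGrad b g) := by
  unfold _root_.discreteGrad
  fun_prop

theorem ContDiff.discreteDeriv (b : OrthonormalBasis ι ℝ V) {Φ : V → V} (hΦ : ContDiff ℝ 1 Φ) :
    ContDiff ℝ 1 (discreteDeriv b Φ) := by
  unfold _root_.discreteDeriv
  refine ContDiff.sum fun i _ => contDiff_const.smulRight ?_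
  fun_prop

theorem mem_ball_of_norm_sub_le {V : Type*} [SeminormedAddCommGroup V] {x z z' : V} {r s : ℝ}
    (hz : z ∈ ball x r) (h : ‖z' - z‖ ≤ s) :
    z' ∈ ball x (r + s) := by
  rw [mem_ball] at *
  have := dist_triangle z' z x
  rw [dist_eq_norm z' z] at this
  linarith

theorem discreteGrad_sub_eq [FiniteDimensional ℝ V] (b : OrthonormalBasis ι ℝ V) (g : V → ℝ) (x : V)
    (K : Submodule ℝ V) (z : V) : discreteGrad b g z - Kᗮ.starProjection (z - x) =
      discreteGrad b (fun z => g z - ‖Kᗮ.starProjection (z - x)‖ ^ 2) z := by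
  have h := b.sum_repr' (Kᗮ.starProjection (z - x))
  conv_lhs => rw [← h]
  unfold discreteGrad
  rw [← Finset.sum_sub_distrib]
  refine Finset.sum_congr rfl fun i _ => ?_
  rw [← sub_smul]
  congr 1
  dsimp only
  have hpol : ∀ p s : V, ‖Kᗮ.starProjection (p + s)‖ ^ 2 - ‖Kᗮ.starProjection (p - s)‖ ^ 2 =
      4 * inner ℝ (Kᗮ.starProjection p) (Kᗮ.starProjection s) := by
    intro p s
    rw [map_add, map_sub, norm_add_sq_real, norm_sub_sq_real]
    ring
  have hpol' := hpol (z - x) ((1 / 16 : ℝ) • b i)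
  rw [map_smul, inner_smul_right] at hpol'
  rw [add_sub_right_comm z _ x, sub_right_comm z _ x]
  have : inner ℝ (Kᗮ.starProjection (z - x)) (Kᗮ.starProjection (b i)) =
      inner ℝ (b i) (Kᗮ.starProjection (z - x)) := by
    rw [← Kᗮ.inner_starProjection_left_eq_right, real_inner_comm,
      Kᗮ.starProjection_eq_self_iff.2 (Kᗮ.starProjection_apply_mem _)]
  rw [this] at hpol'
  linear_combination 4 * hpol'

theorem NearQuadratic.discreteGrad [FiniteDimensional ℝ V] (b : OrthonormalBasis ι ℝ V)
    {g : V → ℝ} {c : ℝ}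
    {x : V} {K : Submodule ℝ V} (h : NearQuadratic g c x K) :
    (∀ z ∈ ball x (5 / 16), ‖discreteGrad b g z - Kᗮ.starProjection (z - x)‖ ≤
      Fintype.card ι * (8 * c)) ∧
    ∀ z ∈ ball x (5 / 16), ∀ z' ∈ ball x (5 / 16),
      ‖(discreteGrad b g z - Kᗮ.starProjection (z - x)) -
        (discreteGrad b g z' - Kᗮ.starProjection (z' - x))‖ ≤
      Fintype.card ι * (8 * c) * ‖z - z'‖ := by
  simp_rw [discreteGrad_sub_eq]
  set e : V → ℝ := fun z => g z - ‖Kᗮ.starProjection (z - x)‖ ^ 2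
  have hp : ∀ z ∈ ball x (5 / 16), ∀ i, z + (1 / 16 : ℝ) • b i ∈ ball x (3 / 8) := by
    intro z hz i
    have := mem_ball_of_norm_sub_le (z' := z + (1 / 16 : ℝ) • b i) (s := 1 / 16) hz
      (by rw [add_sub_cancel_left, norm_smul, b.norm_eq_one]; norm_num)
    norm_num at this ⊢; exact this
  have hm : ∀ z ∈ ball x (5 / 16), ∀ i, z - (1 / 16 : ℝ) • b i ∈ ball x (3 / 8) := by
    intro z hz i
    have := mem_ball_of_norm_sub_le (z' := z - (1 / 16 : ℝ) • b i) (s := 1 / 16) hz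
      (by rw [sub_sub_cancel_left, norm_neg, norm_smul, b.norm_eq_one]; norm_num)
    norm_num at this ⊢; exact this
  constructor
  · intro z hz
    refine norm_sum_smul_orthonormalBasis_le b fun i => ?_
    have h1 := h _ (hp z hz i) _ (hm z hz i)
    change |e _ - e _| ≤ _ at h1
    rw [add_sub_sub_cancel, ← two_smul ℝ, norm_smul, norm_smul, b.norm_eq_one] at h1
    norm_num at h1
    rw [abs_mul, abs_of_pos (by norm_num : (0 : ℝ) < 4)]
    have := abs_nonneg (e (z + (1 / 16 : ℝ) • b i) - e (z - (1 / 16 : ℝ) • b i))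
    norm_num
    linarith
  · intro z hz z' hz'
    unfold _root_.discreteGrad
    rw [← Finset.sum_sub_distrib, mul_assoc]
    simp_rw [← sub_smul]
    refine norm_sum_smul_orthonormalBasis_le b fun i => ?_
    have h1 := h _ (hp z hz i) _ (hp z' hz' i)
    have h2 := h _ (hm z hz i) _ (hm z' hz' i)
    rw [add_sub_add_right_eq_sub] at h1
    rw [sub_sub_sub_cancel_right] at h2
    change |e _ - e _| ≤ _ at h1
    change |e _ - e _| ≤ _ at h2
    rw [abs_le] at *
    constructor <;> linarith

theorem discreteDeriv_sub_eq (b : OrthonormalBasis ι ℝ V) (Φ : V → V) (T : V →L[ℝ] V) (x z : V) :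
    discreteDeriv b Φ z - T = discreteDeriv b (fun z => Φ z - T (z - x)) z := by
  have h : T = ∑ i, (innerSL ℝ (b i)).smulRight (T (b i)) := by
    ext v
    conv_lhs => rw [← b.sum_repr' v]
    simp
  conv_lhs => rw [h]
  unfold discreteDeriv
  rw [← Finset.sum_sub_distrib]
  refine Finset.sum_congr rfl fun i _ => ?_
  have h2 : (16 : ℝ) • (Φ (z + (1 / 16 : ℝ) • b i) - T (z + (1 / 16 : ℝ) • b i - x) -
      (Φ z - T (z - x))) = (16 : ℝ) • (Φ (z + (1 / 16 : ℝ) • b i) - Φ z) - T (b i) := by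
    rw [add_sub_right_comm z _ x, map_add, map_smul]
    module
  rw [h2]
  ext v
  simp [smul_sub]

theorem norm_sum_innerSL_smulRight_le (b : OrthonormalBasis ι ℝ V) {c : ℝ} {a : ι → V}
    (ha : ∀ i, ‖a i‖ ≤ c) : ‖∑ i, (innerSL ℝ (b i)).smulRight (a i)‖ ≤ Fintype.card ι * c := by
  refine (norm_sum_le _ _).trans ?_
  refine (Finset.sum_le_sum (g := fun _ => c) fun i _ => ?_).trans (le_of_eq ?_)
  · rw [ContinuousLinearMap.norm_smulRight_apply, innerSL_apply_norm, b.norm_eq_one, one_mul]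
    exact ha i
  · simp

theorem discreteDeriv_estimates (b : OrthonormalBasis ι ℝ V) {Φ : V → V} {c : ℝ} {x : V}
    {T : V →L[ℝ] V}
    (h : ∀ z ∈ ball x (5 / 16), ∀ z' ∈ ball x (5 / 16),
      ‖(Φ z - T (z - x)) - (Φ z' - T (z' - x))‖ ≤ c * ‖z - z'‖) :
    (∀ z ∈ ball x (1 / 4), ‖discreteDeriv b Φ z - T‖ ≤ Fintype.card ι * (32 * c)) ∧
    ∀ z ∈ ball x (1 / 4), ∀ z' ∈ ball x (1 / 4),
      ‖discreteDeriv b Φ z - discreteDeriv b Φ z'‖ ≤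
        Fintype.card ι * (32 * c) * ‖z - z'‖ := by
  have hp : ∀ z ∈ ball x (1 / 4), ∀ i, z + (1 / 16 : ℝ) • b i ∈ ball x (5 / 16) := by
    intro z hz i
    have := mem_ball_of_norm_sub_le (z' := z + (1 / 16 : ℝ) • b i) (s := 1 / 16) hz
      (by rw [add_sub_cancel_left, norm_smul, b.norm_eq_one]; norm_num)
    norm_num at this ⊢; exact this
  have hb : ball x (1 / 4) ⊆ ball x (5 / 16) := ball_subset_ball (by norm_num)
  constructor
  · intro z hz
    rw [discreteDeriv_sub_eq b Φ T x]
    refine norm_sum_innerSL_smulRight_le b fun i => ?_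
    have h1 := h _ (hp z hz i) z (hb hz)
    rw [add_sub_cancel_left, norm_smul, b.norm_eq_one] at h1
    rw [norm_smul]
    have h2 := (norm_nonneg _).trans h1
    norm_num at h1 h2 ⊢
    linarith
  · intro z hz z' hz'
    rw [← sub_sub_sub_cancel_right _ _ T, discreteDeriv_sub_eq b Φ T x,
      discreteDeriv_sub_eq b Φ T x, discreteDeriv, discreteDeriv, ← Finset.sum_sub_distrib,
      mul_assoc]
    have hsub : ∀ i (u v : V), (innerSL ℝ (b i)).smulRight u - (innerSL ℝ (b i)).smulRight v =
        (innerSL ℝ (b i)).smulRight (u - v) := by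
      intro i u v; ext w; simp [smul_sub]
    simp_rw [hsub]
    refine norm_sum_innerSL_smulRight_le b fun i => ?_
    have h1 := h _ (hp z hz i) _ (hp z' hz' i)
    have h2 := h z (hb hz) z' (hb hz')
    rw [add_sub_add_right_eq_sub] at h1
    rw [← smul_sub, norm_smul, sub_sub_sub_comm]
    have h3 := norm_sub_le_of_le h1 h2
    norm_num at h3 ⊢
    linarith

end DiscreteDerivatives

section BanachAlgebra

variable {A : Type*} [NormedRing A] [NormedAlgebra ℝ A]

variable (A) in
theorem exists_contDiffAt_sqrt_near_one [CompleteSpace A] :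
    ∃ s : A → A, ∃ η : ℝ, 0 < η ∧ ∃ L : ℝ, 0 ≤ L ∧ s 1 = 1 ∧
      (∀ y ∈ ball (1 : A) η, ContDiffAt ℝ 1 s y ∧ s y * s y = y) ∧
      ∀ y ∈ ball (1 : A) η, ∀ y' ∈ ball (1 : A) η, ‖s y - s y'‖ ≤ L * ‖y - y'‖ := by
  have hf : ContDiff ℝ 1 (fun a : A => a * a) := contDiff_id.mul contDiff_id
  let T : A ≃L[ℝ] A := ContinuousLinearEquiv.smulLeft (Units.mk0 (2 : ℝ) two_ne_zero)
  have hT : HasFDerivAt (fun a : A => a * a) (T : A →L[ℝ] A) 1 := by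
    refine ((hasFDerivAt_id (𝕜 := ℝ) (1 : A)).mul'
      (hasFDerivAt_id (𝕜 := ℝ) (1 : A))).congr_fderiv ?_
    ext v
    change (1 : A) * v + v * 1 = (2 : ℝ) • v
    rw [one_mul, mul_one, two_smul]
  have hstrict := hf.contDiffAt.hasStrictFDerivAt' hT one_ne_zero
  have hs : ContDiffAt ℝ 1 (HasStrictFDerivAt.localInverse _ T 1 hstrict) (1 * 1) :=
    hf.contDiffAt.to_localInverse hT one_ne_zero
  have h1 := hstrict.localInverse_apply_image
  have h2 := hstrict.eventually_right_inverse
  set s := HasStrictFDerivAt.localInverse _ T 1 hstrict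
  simp only [mul_one] at hs h1 h2
  obtain ⟨L, t, ht, hL⟩ := hs.exists_lipschitzOnWith
  obtain ⟨η, hη, hball⟩ := Metric.eventually_nhds_iff_ball.1
    ((hs.eventually (by simp)).and (h2.and ht))
  refine ⟨s, η, hη, L, L.2, h1, fun y hy => ⟨(hball y hy).1, (hball y hy).2.1⟩, ?_⟩
  intro y hy y' hy'
  exact hL.norm_sub_le (hball y hy).2.2 (hball y' hy').2.2

theorem commute_of_mul_self_eq {M B : A} (h : M * M = B * B) (hM : ‖M - 1‖ < 1) :
    Commute M B := by
  obtain ⟨X, hX⟩ : ∃ X, X = M * B - B * M := ⟨_, rfl⟩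
  have h1 : M * X = -(X * M) := by
    rw [hX, mul_sub, sub_mul, ← mul_assoc, h, mul_assoc B M M, h, mul_assoc M B M, mul_assoc B B B]
    abel
  have h2 : X + X = -((M - 1) * X + X * (M - 1)) := by
    rw [sub_mul, mul_sub, h1, one_mul, mul_one]; abel
  have h3 : 2 * ‖X‖ ≤ 2 * (‖M - 1‖ * ‖X‖) := by
    have h4 : ‖X + X‖ = 2 * ‖X‖ := by
      rw [← two_smul ℝ X, norm_smul]; norm_num
    rw [← h4, h2, norm_neg]
    refine (norm_add_le _ _).trans ?_
    have h5 := norm_mul_le (M - 1) X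
    have h6 := norm_mul_le X (M - 1)
    linarith
  have h4 : ‖X‖ = 0 := by nlinarith [norm_nonneg X]
  exact sub_eq_zero.1 (hX ▸ norm_eq_zero.1 h4)

end BanachAlgebra

theorem norm_mul_self_sub_mul_self_le {A : Type*} [NormedRing A] (x y : A) :
    ‖x * x - y * y‖ ≤ (‖x‖ + ‖y‖) * ‖x - y‖ := by
  have h : x * x - y * y = x * (x - y) + (x - y) * y := by noncomm_ring
  rw [h]
  refine (norm_add_le _ _).trans ?_
  have h1 := norm_mul_le x (x - y)
  have h2 := norm_mul_le (x - y) y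
  linarith

theorem add_apply_eq_zero_of_commute {V : Type*} [NormedAddCommGroup V] [NormedSpace ℝ V]
    {M B Q : V →L[ℝ] V} (hc : Commute M B) (h : M * M = B * B)
    (hQ : ‖(M - B) - (2 : ℝ) • (1 - Q)‖ < 2) {v : V} (hv : Q ((M + B) v) = 0) :
    (M + B) v = 0 := by
  have h1 : (M - B) * (M + B) = 0 := by
    rw [sub_mul, mul_add, mul_add, hc.eq, h]; abel
  set w := (M + B) v with hw
  have h2 : (M - B) w = 0 := by
    rw [hw, ← mul_apply_eq_comp, h1]; rfl
  have h3 : ((M - B) - (2 : ℝ) • (1 - Q)) w = -((2 : ℝ) • w) := by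
    rw [sub_apply, h2]
    simp [hv]
  have h4 := ((M - B) - (2 : ℝ) • (1 - Q)).le_opNorm w
  rw [h3, norm_neg, norm_smul, Real.norm_ofNat] at h4
  by_contra hne
  have := norm_pos_iff.2 hne
  nlinarith

/-- A `C¹` selection of operators with the same kernel condition as a nearby projection. -/
theorem exists_near_projection (V : Type*) [NormedAddCommGroup V] [NormedSpace ℝ V]
    [CompleteSpace V] :
    ∃ N : (V →L[ℝ] V) → (V →L[ℝ] V), ∃ η : ℝ, 0 < η ∧ ∃ C : ℝ, 0 ≤ C ∧
      ∀ Q : V →L[ℝ] V, Q * Q = Q → ‖Q‖ ≤ 1 →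
        (∀ A, ‖A - Q‖ < η → ContDiffAt ℝ 1 N A ∧ ‖N A - Q‖ ≤ C * ‖A - Q‖ ∧
          ∀ v, Q (N A v) = 0 → N A v = 0) ∧
        ∀ A A', ‖A - Q‖ < η → ‖A' - Q‖ < η → ‖N A - N A'‖ ≤ C * ‖A - A'‖ := by
  obtain ⟨s, η, hη, L, hL, hs1, hs, hlip⟩ := exists_contDiffAt_sqrt_near_one (V →L[ℝ] V)
  let B : (V →L[ℝ] V) → (V →L[ℝ] V) := fun A => (2 : ℝ) • A - 1
  have hB : ∀ A A', ‖B A - B A'‖ = 2 * ‖A - A'‖ := by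
    intro A A'
    simp only [B]
    rw [sub_sub_sub_cancel_right, ← smul_sub, norm_smul, Real.norm_ofNat]
  set κ : ℝ := min (1 / 2) (min (η / 14) (1 / (14 * L + 2))) with hκ
  have hκ0 : 0 < κ := by positivity
  have hκ1 : κ ≤ 1 / 2 := min_le_left _ _
  have hκ2 : κ ≤ η / 14 := (min_le_right _ _).trans (min_le_left _ _)
  have hκ3 : κ ≤ 1 / (14 * L + 2) := (min_le_right _ _).trans (min_le_right _ _)
  rw [le_div_iff₀ (by positivity)] at hκ2 hκ3
  refine ⟨fun A => (1 / 2 : ℝ) • (s (B A * B A) + B A), κ, hκ0, 8 * L + 1, by positivity, ?_⟩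
  intro Q hQ hQ1
  have hone : ‖(1 : V →L[ℝ] V)‖ ≤ 1 := ContinuousLinearMap.norm_id_le
  have hS : B Q * B Q = 1 := by
    have : B Q * B Q = (4 : ℝ) • (Q * Q) - (4 : ℝ) • Q + 1 := by
      simp only [B, sub_mul, mul_sub, smul_mul_smul_comm, mul_one, one_mul]
      module
    rw [this, hQ]; abel
  have hSn : ‖B Q‖ ≤ 3 := by
    refine (norm_sub_le _ _).trans ?_
    rw [norm_smul, Real.norm_ofNat]; linarith
  have hBn : ∀ A, ‖A - Q‖ < κ → ‖B A‖ ≤ 4 := by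
    intro A hA
    have h1 := norm_le_norm_add_norm_sub' (B A) (B Q)
    rw [hB] at h1
    linarith
  have hB2 : ∀ A, ‖A - Q‖ < κ → ‖B A * B A - 1‖ ≤ 14 * ‖A - Q‖ := by
    intro A hA
    rw [← hS]
    refine (norm_mul_self_sub_mul_self_le _ _).trans ?_
    rw [hB]
    have := hBn A hA
    nlinarith [norm_nonneg (A - Q)]
  have hball : ∀ A, ‖A - Q‖ < κ → B A * B A ∈ ball 1 η := by
    intro A hA
    rw [mem_ball, dist_eq_norm]
    linarith [hB2 A hA]
  have hM1 : ∀ A, ‖A - Q‖ < κ → ‖s (B A * B A) - 1‖ ≤ L * (14 * ‖A - Q‖) := by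
    intro A hA
    have h := hlip _ (hball A hA) 1 (mem_ball_self hη)
    rw [hs1] at h
    exact h.trans (by gcongr; exact hB2 A hA)
  constructor
  · intro A hA
    refine ⟨?_, ?_, ?_⟩
    · have hBc : ContDiff ℝ 1 B := by simp only [B]; fun_prop
      have h1 : ContDiffAt ℝ 1 (fun A => s (B A * B A)) A :=
        ContDiffAt.comp A (hs _ (hball A hA)).1 (hBc.mul hBc).contDiffAt
      exact (h1.add hBc.contDiffAt).const_smul _
    · have h1 : (1 / 2 : ℝ) • (s (B A * B A) + B A) - Q =
          (1 / 2 : ℝ) • ((s (B A * B A) - 1) + (B A - B Q)) := by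
        simp only [B]; module
      rw [h1, norm_smul]
      have h2 := norm_add_le (s (B A * B A) - 1) (B A - B Q)
      rw [hB] at h2
      have h3 := hM1 A hA
      have h4 : 0 ≤ L * ‖A - Q‖ := by positivity
      norm_num
      linarith
    · intro v hv
      have h1 := hM1 A hA
      have h2 : L * (14 * ‖A - Q‖) + 2 * ‖A - Q‖ < 1 := by
        have : (14 * L + 2) * ‖A - Q‖ < (14 * L + 2) * κ := by gcongr
        linarith
      have h3 : ‖s (B A * B A) - 1‖ < 1 := by linarith [norm_nonneg (A - Q)]
      have h4 := (hs _ (hball A hA)).2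
      have h5 : (s (B A * B A) - B A) - (2 : ℝ) • (1 - Q) =
          (s (B A * B A) - 1) - (B A - B Q) := by
        simp only [B]; module
      have h6 := norm_sub_le (s (B A * B A) - 1) (B A - B Q)
      rw [hB, ← h5] at h6
      have h7 := add_apply_eq_zero_of_commute (Q := Q) (commute_of_mul_self_eq h4 h3) h4
        (by linarith) (v := v)
      rw [smul_apply, map_smul, smul_eq_zero] at hv
      rw [smul_apply, h7 (hv.resolve_left (by norm_num)), smul_zero]
  · intro A A' hA hA'
    rw [← smul_sub, add_sub_add_comm, norm_smul]
    have h1 := norm_add_le (s (B A * B A) - s (B A' * B A')) (B A - B A')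
    have h2 := hlip _ (hball A hA) _ (hball A' hA')
    have h3 := norm_mul_self_sub_mul_self_le (B A) (B A')
    rw [hB] at h1 h3
    have h4 : ‖B A * B A - B A' * B A'‖ ≤ 16 * ‖A - A'‖ := by
      nlinarith [hBn A hA, hBn A' hA', norm_nonneg (A - A')]
    have h5 : L * ‖B A * B A - B A' * B A'‖ ≤ L * (16 * ‖A - A'‖) := by gcongr
    norm_num
    linarith

section DefiningFunction

variable (V : Type*) [NormedAddCommGroup V] [InnerProductSpace ℝ V] [FiniteDimensional ℝ V]

/-- A function whose zero set is, near every point `x` at which `E` is flat, a graph over the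
approximating plane: it is `C¹`-close to the projection onto the orthogonal complement, and vanishes
as soon as its projection does. -/
theorem exists_defining_function [MeasurableSpace V] [BorelSpace V] :
    ∃ C : ℝ, 0 ≤ C ∧ ∃ ε₀ : ℝ, 0 < ε₀ ∧ ∀ E : Set V, IsClosed E → ∃ G : V → V,
      ∀ ε : ℝ, 0 < ε → ε < ε₀ → ∀ x ∈ E, ∀ K : Submodule ℝ V, FlatAt E ε x K →
        (∀ z ∈ ball x (1 / 4), ContDiffAt ℝ 1 G z ∧ ‖G z - Kᗮ.starProjection (z - x)‖ ≤ C * ε ∧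
          (Kᗮ.starProjection (G z) = 0 → G z = 0)) ∧
        ∀ z ∈ ball x (1 / 4), ∀ z' ∈ ball x (1 / 4),
          ‖(G z - Kᗮ.starProjection (z - x)) - (G z' - Kᗮ.starProjection (z' - x))‖ ≤
            C * ε * ‖z - z'‖ := by
  obtain ⟨C₁, hC₁, hg⟩ := exists_nearQuadratic V
  obtain ⟨N, η, hη, C₂, hC₂, hN⟩ := exists_near_projection V
  let b := stdOrthonormalBasis ℝ V
  set m : ℝ := (Fintype.card (Fin (Module.finrank ℝ V)) : ℝ)
  have hm : 0 ≤ m := Nat.cast_nonneg _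
  set c₁ : ℝ := m * (8 * C₁)
  have hc₁ : 0 ≤ c₁ := by positivity
  set c₂ : ℝ := m * (32 * c₁)
  have hc₂ : 0 ≤ c₂ := by positivity
  set c₃ : ℝ := C₂ * c₂
  have hc₃ : 0 ≤ c₃ := by positivity
  refine ⟨2 * c₃ * (1 + c₁) + c₁, by positivity, min 1 (η / (c₂ + 1)), by positivity, ?_⟩
  intro E hE
  obtain ⟨g, hgs, hgE⟩ := hg E hE
  have hΦs := hgs.discreteGrad b
  set Φ := discreteGrad b g with hΦ
  have hAs := hΦs.discreteDeriv b
  set A := discreteDeriv b Φ with hA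
  refine ⟨fun z => N (A z) (Φ z), ?_⟩
  intro ε hε hε₀ x hx K hK
  have hε1 : ε ≤ 1 := hε₀.le.trans (min_le_left _ _)
  have hε2 : c₂ * ε < η := by
    have := hε₀.trans_le (min_le_right _ _)
    rw [lt_div_iff₀ (by positivity)] at this
    linarith
  set Q := Kᗮ.starProjection with hQdef
  have hQQ : Q * Q = Q := Kᗮ.isIdempotentElem_starProjection
  have hQQ' : ∀ v, Q (Q v) = Q v := fun v => congrArg (fun T : V →L[ℝ] V => T v) hQQ
  have hQ1 : ‖Q‖ ≤ 1 := Kᗮ.starProjection_norm_le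
  have hQle : ∀ v, ‖Q v‖ ≤ ‖v‖ := Kᗮ.norm_starProjection_apply_le
  obtain ⟨hN1, hN2⟩ := hN Q hQQ hQ1
  obtain ⟨hΦ1, hΦ2⟩ := (hgE ε x hx K hK).discreteGrad b
  rw [← hΦ] at hΦ1 hΦ2
  have hcc : m * (8 * (C₁ * ε)) = c₁ * ε := by simp only [c₁]; ring
  change ∀ z ∈ ball x (5 / 16), _ ≤ m * (8 * (C₁ * ε)) at hΦ1
  change ∀ z ∈ ball x (5 / 16), ∀ z' ∈ ball x (5 / 16), _ ≤ m * (8 * (C₁ * ε)) * _ at hΦ2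
  rw [hcc] at hΦ1 hΦ2
  obtain ⟨hA1, hA2⟩ := discreteDeriv_estimates b hΦ2
  change ∀ z ∈ ball x (1 / 4), _ ≤ m * (32 * (c₁ * ε)) at hA1
  change ∀ z ∈ ball x (1 / 4), ∀ z' ∈ ball x (1 / 4), _ ≤ m * (32 * (c₁ * ε)) * _ at hA2
  have hcc' : m * (32 * (c₁ * ε)) = c₂ * ε := by simp only [c₂]; ring
  rw [hcc', ← hA] at hA1 hA2
  have hb : ball x (1 / 4) ⊆ ball x (5 / 16) := ball_subset_ball (by norm_num)
  have hAη : ∀ z ∈ ball x (1 / 4), ‖A z - Q‖ < η := fun z hz => (hA1 z hz).trans_lt hε2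
  have hNQ : ∀ z ∈ ball x (1 / 4), ‖N (A z) - Q‖ ≤ c₃ * ε := by
    intro z hz
    refine (hN1 _ (hAη z hz)).2.1.trans ?_
    rw [mul_assoc]
    gcongr
    exact hA1 z hz
  have hNlip : ∀ z ∈ ball x (1 / 4), ∀ z' ∈ ball x (1 / 4),
      ‖N (A z) - N (A z')‖ ≤ c₃ * ε * ‖z - z'‖ := by
    intro z hz z' hz'
    refine (hN2 _ _ (hAη z hz) (hAη z' hz')).trans ?_
    have := mul_le_mul_of_nonneg_left (hA2 z hz z' hz') hC₂
    refine this.trans (le_of_eq ?_)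
    simp only [c₃]; ring
  have hcε : c₁ * ε ≤ c₁ := mul_le_of_le_one_right hc₁ hε1
  have hΦn : ∀ z ∈ ball x (1 / 4), ‖Φ z‖ ≤ 1 + c₁ := by
    intro z hz
    have h1 := norm_le_norm_add_norm_sub' (Φ z) (Q (z - x))
    have h2 := hΦ1 z (hb hz)
    have h3 := hQle (z - x)
    rw [mem_ball, dist_eq_norm] at hz
    linarith
  have hΦlip : ∀ z ∈ ball x (1 / 4), ∀ z' ∈ ball x (1 / 4),
      ‖Φ z - Φ z'‖ ≤ (1 + c₁) * ‖z - z'‖ := by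
    intro z hz z' hz'
    have h1 : Φ z - Φ z' = Q (z - z') +
        ((Φ z - Q (z - x)) - (Φ z' - Q (z' - x))) := by
      rw [map_sub, map_sub, map_sub]; abel
    rw [h1]
    have h2 := norm_add_le (Q (z - z')) ((Φ z - Q (z - x)) - (Φ z' - Q (z' - x)))
    have h3 := hΦ2 z (hb hz) z' (hb hz')
    have h4 := hQle (z - z')
    have h5 : c₁ * ε * ‖z - z'‖ ≤ c₁ * ‖z - z'‖ := by gcongr
    linarith
  have hdecomp : ∀ z, N (A z) (Φ z) - Q (z - x) =
      (N (A z) - Q) (Φ z) + Q (Φ z - Q (z - x)) := by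
    intro z
    rw [map_sub Q (Φ z), hQQ', sub_apply]; abel
  refine ⟨fun z hz => ⟨?_, ?_, (hN1 _ (hAη z hz)).2.2 _⟩, ?_⟩
  · exact (ContDiffAt.comp z (hN1 _ (hAη z hz)).1 hAs.contDiffAt).clm_apply hΦs.contDiffAt
  · rw [hdecomp]
    refine (norm_add_le _ _).trans ?_
    have h1 := (N (A z) - Q).le_opNorm (Φ z)
    have h2 := mul_le_mul (hNQ z hz) (hΦn z hz) (norm_nonneg _) (by positivity)
    have h3 := (hQle (Φ z - Q (z - x))).trans (hΦ1 z (hb hz))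
    have h4 : 0 ≤ c₃ * ε * (1 + c₁) := by positivity
    linarith
  · intro z hz z' hz'
    have h0 : (N (A z) (Φ z) - Q (z - x)) - (N (A z') (Φ z') - Q (z' - x)) =
        (N (A z) - Q) (Φ z - Φ z') + (N (A z) - N (A z')) (Φ z') +
          Q ((Φ z - Q (z - x)) - (Φ z' - Q (z' - x))) := by
      rw [hdecomp, hdecomp, map_sub Q (Φ z - Q (z - x))]
      simp only [sub_apply, map_sub]
      abel
    rw [h0]
    refine norm_add₃_le.trans ?_
    have h1 := ((N (A z) - Q).le_opNorm (Φ z - Φ z')).trans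
      (mul_le_mul (hNQ z hz) (hΦlip z hz z' hz') (norm_nonneg _) (by positivity))
    have h2 := ((N (A z) - N (A z')).le_opNorm (Φ z')).trans
      (mul_le_mul (hNlip z hz z' hz') (hΦn z' hz') (norm_nonneg _) (by positivity))
    have h3 := (hQle ((Φ z - Q (z - x)) - (Φ z' - Q (z' - x)))).trans (hΦ2 z (hb hz) z' (hb hz'))
    linarith

end DefiningFunction

section Graphs

variable {V : Type*} [NormedAddCommGroup V] [InnerProductSpace ℝ V] [FiniteDimensional ℝ V]

/-- A `C¹` perturbation of the projection onto `Kᗮ`, with small Lipschitz constant, vanishes exactly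
on a `C¹` Lipschitz graph over `K`. -/
theorem exists_graph_of_lipschitz_perturbation (K : Submodule ℝ V) {H : V → V}
    (hH : ContDiff ℝ 1 H) (hHK : ∀ v, H v ∈ Kᗮ) {c : NNReal} (hc : c ≤ 1 / 2)
    (hlip : LipschitzWith c H) :
    ∃ F : K → (Kᗮ : Submodule ℝ V), ContDiff ℝ 1 F ∧ LipschitzWith (2 * c) F ∧
      ∀ v : V, Kᗮ.starProjection v + H v = 0 ↔ ∃ w : K, v = w + F w := by
  have hc1 : c < 1 := hc.trans_lt (by rw [← NNReal.coe_lt_coe]; norm_num)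
  let Θ : V → V := fun v => v + H v
  have hΘ : ContDiff ℝ 1 Θ := contDiff_id.add hH
  have happ : ApproximatesLinearOn Θ (ContinuousLinearEquiv.refl ℝ V : V →L[ℝ] V) univ c := by
    intro v _ v' _
    have : Θ v - Θ v' - (ContinuousLinearEquiv.refl ℝ V : V →L[ℝ] V) (v - v') = H v - H v' := by
      simp only [Θ, ContinuousLinearEquiv.coe_refl, ContinuousLinearMap.id_apply]; abel
    rw [this]
    exact hlip.norm_sub_le v v'
  have hcond : Subsingleton V ∨
      c < ‖((ContinuousLinearEquiv.refl ℝ V).symm : V →L[ℝ] V)‖₊⁻¹ := by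
    rcases subsingleton_or_nontrivial V with h | h
    · exact Or.inl h
    · right
      have : ‖((ContinuousLinearEquiv.refl ℝ V).symm : V →L[ℝ] V)‖₊ = 1 := by
        rw [← NNReal.coe_inj]
        simp
      rw [this, inv_one]
      exact hc1
  let e : V ≃ₜ V := happ.toHomeomorph Θ hcond
  have he : ⇑e = Θ := rfl
  have hDH : ∀ v, ‖-fderiv ℝ H v‖ < 1 := by
    intro v
    rw [norm_neg]
    exact (norm_fderiv_le_of_lipschitz ℝ hlip).trans_lt hc1
  have hder : ∀ v, HasFDerivAt e
      (ContinuousLinearEquiv.ofUnit (Units.oneSub _ (hDH v)) : V →L[ℝ] V) v := by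
    intro v
    have h1 : HasFDerivAt Θ (ContinuousLinearMap.id ℝ V + fderiv ℝ H v) v :=
      (hasFDerivAt_id v).add (hH.differentiable one_ne_zero v).hasFDerivAt
    convert h1 using 1
    ext w
    change (1 - -fderiv ℝ H v : V →L[ℝ] V) w = _
    simp
  have hsymm : ContDiff ℝ 1 e.symm := e.contDiff_symm hder hΘ
  have heq : ∀ v, e.symm v + H (e.symm v) = v := e.apply_symm_apply
  let F : K → (Kᗮ : Submodule ℝ V) := fun w =>
    ⟨-H (e.symm w), neg_mem (hHK _)⟩
  have hFe : ∀ w : K, e.symm w = w + F w := by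
    intro w
    have := heq w
    change e.symm w = w + -H (e.symm w)
    rw [← sub_eq_add_neg, eq_sub_iff_add_eq, this]
  refine ⟨F, ?_, ?_, ?_⟩
  · have h1 : ContDiff ℝ 1 (fun w : K => ((F w : (Kᗮ : Submodule ℝ V)) : V)) :=
      (hH.comp (hsymm.comp K.subtypeL.contDiff)).neg
    have h2 : F = fun w => Kᗮ.orthogonalProjectionOnto (F w : V) := by
      funext w; simp
    rw [h2]
    exact (Kᗮ.orthogonalProjectionOnto).contDiff.comp h1
  · refine LipschitzWith.of_dist_le_mul fun w w' => ?_
    have h1 : ‖F w - F w'‖ ≤ c * ‖e.symm w - e.symm w'‖ := by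
      have := hlip.norm_sub_le (e.symm w') (e.symm w)
      rw [norm_sub_rev (e.symm _)] at this
      refine le_trans (le_of_eq ?_) this
      change ‖-H (e.symm w) - -H (e.symm w')‖ = _
      rw [neg_sub_neg]
    have h2 : ‖e.symm w - e.symm w'‖ ≤ ‖w - w'‖ + ‖F w - F w'‖ := by
      rw [hFe, hFe, add_sub_add_comm]
      exact norm_add_le _ _
    have h3 : (c : ℝ) ≤ 1 / 2 := by exact_mod_cast hc
    have h4 : (c : ℝ) * ‖e.symm w - e.symm w'‖ ≤ c * (‖w - w'‖ + ‖F w - F w'‖) := by gcongr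
    have h5 : (c : ℝ) * ‖F w - F w'‖ ≤ 1 / 2 * ‖F w - F w'‖ := by gcongr
    rw [dist_eq_norm, dist_eq_norm, NNReal.coe_mul, NNReal.coe_ofNat]
    linarith
  · intro v
    constructor
    · intro hv
      have h1 : Θ v = K.starProjection v := by
        have h2 := K.starProjection_add_starProjection_orthogonal v
        simp only [Θ]
        rw [eq_neg_of_add_eq_zero_right hv, ← sub_eq_add_neg, sub_eq_iff_eq_add]
        exact h2.symm
      refine ⟨⟨K.starProjection v, K.starProjection_apply_mem v⟩, ?_⟩
      rw [← hFe]
      exact (e.symm_apply_eq.2 h1.symm).symm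
    · rintro ⟨w, rfl⟩
      rw [← hFe]
      have h1 := congrArg Kᗮ.starProjection (heq w)
      rw [map_add, Kᗮ.starProjection_eq_self_iff.2 (hHK _)] at h1
      rw [h1]
      exact Submodule.starProjection_orthogonal_apply_eq_zero w.2

variable (V) in
/-- Extension of functions from a ball to the whole space, with control of the Lipschitz
constant. -/
theorem exists_global_extension :
    ∃ C : ℝ, 1 ≤ C ∧ ∀ (x : V) (f : V → V) (c : ℝ),
      (∀ z ∈ ball x (1 / 4), ContDiffAt ℝ 1 f z) → (∀ z ∈ ball x (1 / 4), ‖f z‖ ≤ c) →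
      (∀ z ∈ ball x (1 / 4), ∀ z' ∈ ball x (1 / 4), ‖f z - f z'‖ ≤ c * ‖z - z'‖) →
      ∃ f' : V → V, ContDiff ℝ 1 f' ∧ (∀ z ∈ ball x (1 / 16), f' z = f z) ∧
        (∀ z, ‖f' z‖ ≤ c) ∧ ∀ z z', ‖f' z - f' z'‖ ≤ C * c * ‖z - z'‖ := by
  let χ : ContDiffBump (0 : V) := ⟨1 / 16, 1 / 8, by norm_num, by norm_num⟩
  have hχs : ContDiff ℝ 1 χ := χ.contDiff (n := 1)
  obtain ⟨L, hL⟩ := hχs.lipschitzWith_of_hasCompactSupport χ.hasCompactSupport (by norm_num)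
  refine ⟨1 + L, by linarith [L.2], ?_⟩
  intro x f c hfs hfn hfl
  have hc : 0 ≤ c := (norm_nonneg _).trans (hfn x (mem_ball_self (by norm_num)))
  have hχ0 : ∀ z ∉ ball x (1 / 8), χ (z - x) = 0 := by
    intro z hz
    apply χ.zero_of_le_dist
    rw [mem_ball, not_lt, dist_eq_norm] at hz
    rwa [dist_zero_right]
  have hb : ball x (1 / 8) ⊆ ball x (1 / 4) := ball_subset_ball (by norm_num)
  have hχabs : ∀ z, |χ z| ≤ 1 := fun z => abs_le.2 ⟨by linarith [χ.nonneg' z], χ.le_one⟩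
  have hχl : ∀ z z', |χ (z - x) - χ (z' - x)| ≤ L * ‖z - z'‖ := by
    intro z z'
    have := hL.norm_sub_le (z - x) (z' - x)
    rwa [sub_sub_sub_cancel_right] at this
  have hout : ∀ z ∈ ball x (1 / 4), ∀ z' ∉ ball x (1 / 4),
      ‖χ (z - x) • f z - χ (z' - x) • f z'‖ ≤ (1 + L) * c * ‖z - z'‖ := by
    intro z hz z' hz'
    have h1 := hχl z z'
    rw [hχ0 z' (fun h => hz' (hb h)), sub_zero] at h1
    rw [hχ0 z' (fun h => hz' (hb h)), zero_smul, sub_zero, norm_smul]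
    calc |χ (z - x)| * ‖f z‖ ≤ (L * ‖z - z'‖) * c :=
          mul_le_mul h1 (hfn z hz) (norm_nonneg _) (by positivity)
      _ ≤ _ := by
          have : 0 ≤ c * ‖z - z'‖ := by positivity
          linarith
  refine ⟨fun z => χ (z - x) • f z, ?_, ?_, ?_, ?_⟩
  · refine contDiff_iff_contDiffAt.2 fun z => ?_
    by_cases hz : z ∈ ball x (1 / 4)
    · exact ContDiffAt.smul (hχs.comp (contDiff_id.sub contDiff_const)).contDiffAt (hfs z hz)
    · refine (contDiffAt_const (c := (0 : V))).congr_of_eventuallyEq ?_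
      have hmem : (closedBall x (1 / 8))ᶜ ∈ nhds z := by
        refine isClosed_closedBall.isOpen_compl.mem_nhds fun h => hz ?_
        exact closedBall_subset_ball (by norm_num) h
      filter_upwards [hmem] with v hv
      rw [hχ0 v (fun h => hv (ball_subset_closedBall h)), zero_smul]
  · intro z hz
    have : χ (z - x) = 1 := by
      apply χ.one_of_mem_closedBall
      rw [mem_closedBall_zero_iff, ← dist_eq_norm]
      exact (mem_ball.1 hz).le
    simp only [this, one_smul]
  · intro z
    dsimp only
    by_cases hz : z ∈ ball x (1 / 4)
    · rw [norm_smul]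
      exact (mul_le_mul (hχabs _) (hfn z hz) (norm_nonneg _) zero_le_one).trans_eq (one_mul c)
    · rw [hχ0 z (fun h => hz (hb h)), zero_smul, norm_zero]
      exact hc
  · intro z z'
    dsimp only
    by_cases hz : z ∈ ball x (1 / 4) <;> by_cases hz' : z' ∈ ball x (1 / 4)
    · have h1 : χ (z - x) • f z - χ (z' - x) • f z' =
          χ (z - x) • (f z - f z') + (χ (z - x) - χ (z' - x)) • f z' := by module
      rw [h1]
      refine (norm_add_le _ _).trans ?_
      rw [norm_smul, norm_smul]
      have h2 := mul_le_mul (hχabs (z - x)) (hfl z hz z' hz') (norm_nonneg _) zero_le_one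
      have h3 := mul_le_mul (hχl z z') (hfn z' hz') (norm_nonneg _) (by positivity)
      rw [Real.norm_eq_abs, Real.norm_eq_abs]
      linarith
    · exact hout z hz z' hz'
    · rw [norm_sub_rev, norm_sub_rev z]
      exact hout z' hz' z hz
    · rw [hχ0 z (fun h => hz (hb h)), hχ0 z' (fun h => hz' (hb h)), zero_smul, zero_smul,
        sub_zero, norm_zero]
      have := L.2
      positivity

variable (V) in
/-- Near `x`, the zero set of a function that is `C¹`-close to a projection is a graph. -/
theorem exists_graph_of_near_projection :
    ∃ C : ℝ, 1 ≤ C ∧ ∀ (G : V → V) (x : V) (K : Submodule ℝ V) (c : ℝ), C * c ≤ 1 / 2 →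
      (∀ z ∈ ball x (1 / 4), ContDiffAt ℝ 1 G z ∧ ‖G z - Kᗮ.starProjection (z - x)‖ ≤ c ∧
        (Kᗮ.starProjection (G z) = 0 → G z = 0)) →
      (∀ z ∈ ball x (1 / 4), ∀ z' ∈ ball x (1 / 4),
        ‖(G z - Kᗮ.starProjection (z - x)) - (G z' - Kᗮ.starProjection (z' - x))‖ ≤
          c * ‖z - z'‖) →
      ∀ y : V, ∃ F : K → (Kᗮ : Submodule ℝ V), ContDiff ℝ 1 F ∧
        LipschitzWith (2 * Real.toNNReal (C * c)) F ∧
        (∀ w, ‖Kᗮ.starProjection (y - x) + F w‖ ≤ c) ∧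
        ∀ z ∈ ball x (1 / 16), G z = 0 ↔ ∃ w : K, z = y + w + F w := by
  obtain ⟨C, hC, hext⟩ := exists_global_extension V
  refine ⟨C, hC, fun G x K c hcC hG1 hG2 y => ?_⟩
  set Q := Kᗮ.starProjection with hQ
  have hQQ : ∀ v, Q (Q v) = Q v := fun v =>
    Kᗮ.starProjection_eq_self_iff.2 (Kᗮ.starProjection_apply_mem _)
  have hQle : ∀ v, ‖Q v‖ ≤ ‖v‖ := Kᗮ.norm_starProjection_apply_le
  obtain ⟨f, hfs, hfeq, hfn, hfl⟩ := hext x (fun z => G z - Q (z - x)) c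
    (fun z hz => (hG1 z hz).1.sub (Q.contDiff.comp (contDiff_id.sub contDiff_const)).contDiffAt)
    (fun z hz => (hG1 z hz).2.1) hG2
  let H : V → V := fun v => Q (y - x) + Q (f (y + v))
  have hHs : ContDiff ℝ 1 H :=
    contDiff_const.add (Q.contDiff.comp (hfs.comp (contDiff_const.add contDiff_id)))
  have hHK : ∀ v, H v ∈ Kᗮ := fun v =>
    add_mem (Kᗮ.starProjection_apply_mem _) (Kᗮ.starProjection_apply_mem _)
  have hHl : LipschitzWith (Real.toNNReal (C * c)) H := by
    refine LipschitzWith.of_dist_le' fun v v' => ?_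
    rw [dist_eq_norm, dist_eq_norm]
    simp only [H]
    rw [add_sub_add_left_eq_sub, ← map_sub]
    refine (hQle _).trans ((hfl _ _).trans_eq ?_)
    rw [add_sub_add_left_eq_sub]
  have hsmall : Real.toNNReal (C * c) ≤ 1 / 2 := by
    rw [Real.toNNReal_le_iff_le_coe]; simpa using hcC
  obtain ⟨F, hFs, hFl, hF⟩ := exists_graph_of_lipschitz_perturbation K hHs hHK hsmall hHl
  refine ⟨F, hFs, hFl, fun w => ?_, fun z hz => ?_⟩
  · have h1 := (hF (w + F w)).2 ⟨w, rfl⟩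
    rw [map_add, Submodule.starProjection_orthogonal_apply_eq_zero w.2, zero_add,
      Kᗮ.starProjection_eq_self_iff.2 (F w).2] at h1
    have h2 : Q (y - x) + F w = -Q (f (y + (w + F w))) := by
      rw [← sub_eq_zero, ← h1]
      simp only [H]
      abel
    rw [h2, norm_neg]
    exact (hQle _).trans (hfn _)
  · have hz' : z ∈ ball x (1 / 4) := ball_subset_ball (by norm_num) hz
    have h1 : Q (z - y) + H (z - y) = Q (G z) := by
      simp only [H]
      rw [add_sub_cancel, hfeq z hz, map_sub Q (G z), hQQ]
      simp only [map_sub]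
      abel
    have h2 : G z = 0 ↔ Q (G z) = 0 := ⟨fun h => by rw [h, map_zero], (hG1 z hz').2.2⟩
    rw [h2, ← h1, hF]
    simp only [sub_eq_iff_eq_add', add_assoc]

variable (V) in
/-- The approximation theorem at scale one. -/
theorem exists_surface_of_flatAt [MeasurableSpace V] [BorelSpace V] (d : ℕ) :
    ∃ ε₀ : ℝ, 0 < ε₀ ∧ ∃ C : ℝ, 1 ≤ C ∧ ∀ E : Set V, IsClosed E → E.Nonempty →
      ∀ ε : ℝ, 0 < ε → ε < ε₀ →
      (∀ x ∈ E, ∃ K : Submodule ℝ V, Module.finrank ℝ K = d ∧ FlatAt E ε x K) →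
      ∃ S : Set V, IsClosed S ∧ S.Nonempty ∧ (∀ x ∈ E, infDist x S ≤ C * ε) ∧
        (∀ z ∈ S, infDist z E ≤ C * ε) ∧
        ∀ y ∈ S, ∃ K : Submodule ℝ V, Module.finrank ℝ K = d ∧
          ∃ F : K → (Kᗮ : Submodule ℝ V), LipschitzWith (Real.toNNReal (C * ε)) F ∧
            ContDiff ℝ 1 F ∧ ∀ z ∈ ball y (1 / 100), z ∈ S ↔ ∃ w : K, z = y + w + F w := by
  obtain ⟨C₁, hC₁, ε₁, hε₁, hdef⟩ := exists_defining_function V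
  obtain ⟨C₂, hC₂, hgraph⟩ := exists_graph_of_near_projection V
  have hC₁₂ : C₁ ≤ C₂ * C₁ := le_mul_of_one_le_left hC₁ hC₂
  set C := 2 * (C₂ * C₁) + 1 with hCdef
  have hC : 1 ≤ C := by linarith
  refine ⟨min ε₁ (1 / (100 * C)), by positivity, C, hC, ?_⟩
  intro E hE hne ε hε hε₀ hflat
  have hε1 : ε < ε₁ := hε₀.trans_le (min_le_left _ _)
  have hε2 : C * ε < 1 / 100 := by
    have := hε₀.trans_le (min_le_right _ _)
    rw [lt_div_iff₀ (by positivity)] at this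
    linarith
  have hCε : C * ε = 2 * (C₂ * C₁ * ε) + ε := by rw [hCdef]; ring
  have hC₁₂ε : C₁ * ε ≤ C₂ * C₁ * ε := by gcongr
  have hC₁ε : 0 ≤ C₁ * ε := by positivity
  have hsmall : C₂ * (C₁ * ε) ≤ 1 / 2 := by rw [← mul_assoc]; linarith
  obtain ⟨G, hG⟩ := hdef E hE
  let S : Set V := {z | infDist z E ≤ 1 / 8} ∩ G ⁻¹' {0}
  have hinner : ∀ x ∈ E, ball x (1 / 8) ⊆ {z | infDist z E ≤ 1 / 8} := fun x hx z hz =>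
    (infDist_le_dist_of_mem hx).trans (mem_ball.1 hz).le
  have hSclosed : IsClosed S := by
    refine ContinuousOn.preimage_isClosed_of_isClosed ?_
      (isClosed_le (continuous_infDist_pt E) continuous_const) isClosed_singleton
    intro z hz
    obtain ⟨x, hx, hzx⟩ := hE.exists_infDist_eq_dist hne z
    obtain ⟨K, -, hK⟩ := hflat x hx
    have hzb : z ∈ ball x (1 / 4) := by
      rw [mem_ball, ← hzx]
      exact (show infDist z E ≤ 1 / 8 from hz).trans_lt (by norm_num)
    exact ((hG ε hε hε1 x hx K hK).1 z hzb).1.continuousAt.continuousWithinAt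
  have hSE : ∀ z ∈ S, infDist z E ≤ C₁ * ε + ε := by
    rintro z ⟨hz, hGz⟩
    obtain ⟨x, hx, hzx⟩ := hE.exists_infDist_eq_dist hne z
    obtain ⟨K, -, hK⟩ := hflat x hx
    have hz8 : dist z x ≤ 1 / 8 := hzx ▸ hz
    have h1 := ((hG ε hε hε1 x hx K hK).1 z (mem_ball.2 (by linarith))).2.1
    rw [show G z = 0 from hGz, zero_sub, norm_neg] at h1
    have h2 := hK.infDist_le (z := z) (by rw [← dist_eq_norm]; linarith)
    linarith
  have hES : ∀ x ∈ E, ∃ z ∈ S, dist x z ≤ C₁ * ε := by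
    intro x hx
    obtain ⟨K, -, hK⟩ := hflat x hx
    obtain ⟨hG1, hG2⟩ := hG ε hε hε1 x hx K hK
    obtain ⟨F, -, -, hFn, hF⟩ := hgraph G x K (C₁ * ε) hsmall hG1 hG2 x
    have h1 := hFn 0
    rw [sub_self, map_zero, zero_add] at h1
    have h2 : dist (x + F 0 : V) x ≤ C₁ * ε := by
      rw [dist_eq_norm, add_sub_cancel_left]; exact h1
    have h3 : dist (x + F 0 : V) x < 1 / 16 := by linarith
    refine ⟨x + F 0, ⟨hinner x hx (mem_ball.2 (by linarith)), ?_⟩, by rwa [dist_comm]⟩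
    exact (hF _ (mem_ball.2 h3)).2 ⟨0, by simp⟩
  refine ⟨S, hSclosed, ?_, ?_, ?_, ?_⟩
  · obtain ⟨x, hx⟩ := hne
    obtain ⟨z, hz, -⟩ := hES x hx
    exact ⟨z, hz⟩
  · intro x hx
    obtain ⟨z, hz, hxz⟩ := hES x hx
    have := infDist_le_dist_of_mem (x := x) hz
    linarith
  · intro z hz
    have := hSE z hz
    linarith
  · intro y hy
    obtain ⟨x, hx, hyx⟩ := hE.exists_infDist_eq_dist hne y
    have h1 := hSE y hy
    rw [hyx] at h1
    obtain ⟨K, hKd, hK⟩ := hflat x hx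
    obtain ⟨hG1, hG2⟩ := hG ε hε hε1 x hx K hK
    obtain ⟨F, hFs, hFl, -, hF⟩ := hgraph G x K (C₁ * ε) hsmall hG1 hG2 y
    refine ⟨K, hKd, F, hFl.weaken ?_, hFs, fun z hz => ?_⟩
    · rw [← NNReal.coe_le_coe, NNReal.coe_mul, Real.coe_toNNReal _ (by positivity),
        Real.coe_toNNReal _ (by positivity), NNReal.coe_ofNat, ← mul_assoc C₂]
      linarith
    · have h2 : dist z x < 1 / 16 := by
        have := dist_triangle z y x
        rw [mem_ball] at hz
        linarith
      rw [← hF z (mem_ball.2 h2)]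
      exact ⟨fun h => h.2, fun h => ⟨hinner x hx (mem_ball.2 (by linarith)), h⟩⟩

end Graphs

section LocDist

variable {n : ℕ}

lemma infDist_le_of_locDist_le {x : EuclideanSpace ℝ (Fin n)} {r ε : ℝ}
    {A B : Set (EuclideanSpace ℝ (Fin n))} (hr : 0 < r) (hA : x ∈ A) (hB : x ∈ B)
    (h : locDist x r A B ≤ ε) :
    (∀ y ∈ A, dist y x ≤ r → infDist y B ≤ ε * r) ∧
      ∀ y ∈ B, dist y x ≤ r → infDist y A ≤ ε * r := by
  have hbdd : ∀ {S T : Set (EuclideanSpace ℝ (Fin n))}, x ∈ T →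
      BddAbove ((fun y => infDist y T) '' (S ∩ closedBall x r)) := by
    rintro S T hT
    refine ⟨r, ?_⟩
    rintro _ ⟨y, hy, rfl⟩
    exact (infDist_le_dist_of_mem hT).trans hy.2
  have hnn : ∀ S T : Set (EuclideanSpace ℝ (Fin n)),
      0 ≤ sSup ((fun y => infDist y T) '' (S ∩ closedBall x r)) := by
    intro S T
    refine Real.sSup_nonneg ?_
    rintro _ ⟨y, -, rfl⟩
    exact infDist_nonneg
  rw [locDist, ← mul_add, inv_mul_le_iff₀ hr, mul_comm] at h
  refine ⟨fun y hy hyx => ?_, fun y hy hyx => ?_⟩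
  · have := le_csSup (hbdd (S := A) hB) (mem_image_of_mem _ ⟨hy, mem_closedBall.2 hyx⟩)
    have := hnn B A
    linarith
  · have := le_csSup (hbdd (S := B) hA) (mem_image_of_mem _ ⟨hy, mem_closedBall.2 hyx⟩)
    have := hnn A B
    linarith

lemma flatAt_of_locDist_le {E : Set (EuclideanSpace ℝ (Fin n))} (hE : IsClosed E) {r ε : ℝ}
    (hr : 0 < r) {x : EuclideanSpace ℝ (Fin n)} (hx : r • x ∈ E)
    {P : AffineSubspace ℝ (EuclideanSpace ℝ (Fin n))} (hxP : r • x ∈ P)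
    (h : locDist (r • x) r E (P : Set (EuclideanSpace ℝ (Fin n))) ≤ ε) :
    FlatAt ((fun z => r • z) ⁻¹' E) ε x P.direction := by
  obtain ⟨h1, h2⟩ := infDist_le_of_locDist_le hr hx hxP h
  refine ⟨fun y hy hyx => ?_, fun w hw hw1 => ?_⟩
  · have h3 : infDist (r • y) (P : Set (EuclideanSpace ℝ (Fin n))) ≤ ε * r := by
      refine h1 _ hy ?_
      rw [dist_eq_norm, ← smul_sub, norm_smul, Real.norm_of_nonneg hr.le]
      exact mul_le_of_le_one_right hr.le hyx
    have h4 : ‖P.directionᗮ.starProjection (r • (y - x))‖ ≤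
        infDist (r • y) (P : Set (EuclideanSpace ℝ (Fin n))) := by
      refine (le_infDist ⟨_, hxP⟩).2 fun p hp => ?_
      have h5 : P.directionᗮ.starProjection (p - r • x) = 0 :=
        (Submodule.starProjection_orthogonal_apply_eq_zero
          (P.vsub_mem_direction hp hxP))
      have h6 : r • (y - x) = (r • y - p) + (p - r • x) := by rw [smul_sub]; abel
      rw [h6, map_add, h5, add_zero, dist_eq_norm]
      exact P.directionᗮ.norm_starProjection_apply_le _
    rw [map_smul, norm_smul, Real.norm_of_nonneg hr.le] at h4
    exact le_of_mul_le_mul_left (by linarith) hr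
  · have h3 : r • x + r • w ∈ P := by
      rw [add_comm]
      exact AffineSubspace.vadd_mem_of_mem_direction (P.direction.smul_mem r hw) hxP
    have h4 := h2 _ h3 (by
      rw [dist_eq_norm, add_sub_cancel_left, norm_smul, Real.norm_of_nonneg hr.le]
      exact mul_le_of_le_one_right hr.le hw1)
    obtain ⟨y, hy, hyd⟩ := hE.exists_infDist_eq_dist ⟨_, hx⟩ (r • x + r • w)
    refine ⟨r⁻¹ • y, by simpa [hr.ne'] using hy, ?_⟩
    rw [hyd, dist_eq_norm] at h4
    have h5 : r • x + r • w - y = r • (x + w - r⁻¹ • y) := by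
      rw [smul_sub, smul_add, smul_inv_smul₀ hr.ne']
    rw [h5, norm_smul, Real.norm_of_nonneg hr.le, mul_comm] at h4
    exact le_of_mul_le_mul_right h4 hr

end LocDist

section Scaling

variable {V : Type*} [NormedAddCommGroup V] [NormedSpace ℝ V]

lemma infDist_preimage_inv_smul_le {r : ℝ} (hr : 0 < r) {S : Set V} (hS : S.Nonempty) (x : V) :
    infDist x ((fun z => r⁻¹ • z) ⁻¹' S) ≤ r * infDist (r⁻¹ • x) S := by
  rw [← inv_mul_le_iff₀ hr]
  refine (le_infDist hS).2 fun s hs => ?_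
  rw [inv_mul_le_iff₀ hr]
  have h1 : r • s ∈ (fun z => r⁻¹ • z) ⁻¹' S := by simpa [hr.ne'] using hs
  refine (infDist_le_dist_of_mem h1).trans_eq ?_
  conv_lhs => rw [← smul_inv_smul₀ hr.ne' x]
  rw [dist_smul₀, Real.norm_of_nonneg hr.le]

end Scaling

/-- Main approximation theorem: there exist `ε₀ > 0` and `C₀ ≥ 1`, depending only on `n`
and `d`, such that if `E ⊂ ℝⁿ` is nonempty closed and every `x ∈ E` admits a `d`-plane `P`
through `x` with `d_{x,r₀}(E,P) ≤ ε < ε₀`, then there is a closed set `Sigma0` which is a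
smooth `d`-dimensional surface (locally the graph, near each of its points `y`, of a
`C₀ ε`-Lipschitz `C¹` map from a `d`-plane through `y` to its orthogonal complement),
with `dist(x,Sigma0) ≤ C₀ ε r₀` for `x ∈ E` and `dist(z,E) ≤ C₀ ε r₀` for `z ∈ Sigma0`. -/
theorem stmt7 (n d : ℕ) (hd : 0 < d) (hdn : d < n) :
    ∃ ε₀ : ℝ, 0 < ε₀ ∧ ∃ C₀ : ℝ, 1 ≤ C₀ ∧
      ∀ E : Set (EuclideanSpace ℝ (Fin n)), IsClosed E → E.Nonempty →
      ∀ r₀ ε : ℝ, 0 < r₀ → 0 < ε → ε < ε₀ →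
      (∀ x ∈ E, ∃ P : AffineSubspace ℝ (EuclideanSpace ℝ (Fin n)),
          x ∈ P ∧ Module.finrank ℝ P.direction = d ∧
          locDist x r₀ E (P : Set (EuclideanSpace ℝ (Fin n))) ≤ ε) →
      ∃ Sigma0 : Set (EuclideanSpace ℝ (Fin n)), IsClosed Sigma0 ∧ Sigma0.Nonempty ∧
        (∀ x ∈ E, Metric.infDist x Sigma0 ≤ C₀ * ε * r₀) ∧
        (∀ z ∈ Sigma0, Metric.infDist z E ≤ C₀ * ε * r₀) ∧
        ∀ y ∈ Sigma0, ∃ K : Submodule ℝ (EuclideanSpace ℝ (Fin n)),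
          Module.finrank ℝ K = d ∧
          ∃ Fm : K → (Kᗮ : Submodule ℝ (EuclideanSpace ℝ (Fin n))),
            LipschitzWith (Real.toNNReal (C₀ * ε)) Fm ∧ ContDiff ℝ 1 Fm ∧
            Sigma0 ∩ Metric.ball y ((10 : ℝ)⁻¹ ^ 2 * r₀)
              = {v | ∃ w : K, v = y + (w : EuclideanSpace ℝ (Fin n))
                  + (Fm w : EuclideanSpace ℝ (Fin n))}
                ∩ Metric.ball y ((10 : ℝ)⁻¹ ^ 2 * r₀) := by
  obtain ⟨ε₀, hε₀, C, hC, H⟩ := exists_surface_of_flatAt (EuclideanSpace ℝ (Fin n)) d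
  refine ⟨ε₀, hε₀, C, hC, fun E hE hne r ε hr hε hεε₀ hflat => ?_⟩
  have hEr : ((fun z => r • z) ⁻¹' E).Nonempty := by
    obtain ⟨x, hx⟩ := hne
    exact ⟨r⁻¹ • x, by simpa [hr.ne'] using hx⟩
  obtain ⟨S, hS, hSne, hES, hSE, hgraph⟩ := H _ (hE.preimage (continuous_const_smul r)) hEr ε hε
    hεε₀ fun x hx => by
      obtain ⟨P, hxP, hPd, hP⟩ := hflat _ hx
      exact ⟨P.direction, hPd, flatAt_of_locDist_le hE hr hx hxP hP⟩
  refine ⟨(fun z => r⁻¹ • z) ⁻¹' S, hS.preimage (continuous_const_smul r⁻¹), ?_, ?_, ?_, ?_⟩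
  · obtain ⟨z, hz⟩ := hSne
    exact ⟨r • z, by simpa [hr.ne'] using hz⟩
  · intro x hx
    have h1 := hES (r⁻¹ • x) (by simpa [hr.ne'] using hx)
    refine (infDist_preimage_inv_smul_le hr hSne x).trans ?_
    rw [mul_comm]
    gcongr
  · intro z hz
    have h1 := hSE _ hz
    have h2 := infDist_preimage_inv_smul_le hr hEr z
    have h3 : (fun z => r⁻¹ • z) ⁻¹' ((fun z => r • z) ⁻¹' E) = E := by
      ext y
      simp [hr.ne']
    rw [h3] at h2
    refine h2.trans ?_
    rw [mul_comm]
    gcongr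
  · intro y hy
    obtain ⟨K, hKd, F, hFl, hFs, hF⟩ := hgraph _ hy
    refine ⟨K, hKd, fun w => r • F (r⁻¹ • w), ?_, ?_, ?_⟩
    · refine LipschitzWith.of_dist_le_mul fun a b => ?_
      have h1 := hFl.dist_le_mul (r⁻¹ • a) (r⁻¹ • b)
      rw [dist_smul₀, Real.norm_of_nonneg hr.le]
      rw [dist_smul₀, Real.norm_of_nonneg (inv_pos.2 hr).le] at h1
      refine (mul_le_mul_of_nonneg_left h1 hr.le).trans_eq ?_
      field_simp
    · exact (hFs.comp (contDiff_id.const_smul r⁻¹)).const_smul r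
    · ext z
      refine and_congr_left fun hz => ?_
      have hz1 : r⁻¹ • z ∈ ball (r⁻¹ • y) (1 / 100) := by
        rw [mem_ball, dist_smul₀, Real.norm_of_nonneg (inv_pos.2 hr).le, inv_mul_lt_iff₀ hr]
        rw [mem_ball] at hz
        refine hz.trans_eq ?_
        norm_num
        ring
      refine (hF _ hz1).trans ⟨?_, ?_⟩
      · rintro ⟨w, hw⟩
        refine ⟨r • w, ?_⟩
        have h1 := congrArg (fun v => r • v) hw
        simpa [hr.ne', smul_add] using h1
      · rintro ⟨w, hw⟩
        refine ⟨r⁻¹ • w, ?_⟩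
        have h1 := congrArg (fun v => r⁻¹ • v) hw
        simpa [hr.ne', smul_add] using h1
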